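/- Let V be a 6-dimensional real vector space, ρ an alternating 3-form on V and ω an alternating 2-form on V, and let φ = ω∧dt + ρ be the induced 3-form on the 7-dimensional space U = ℝ ⊕ V (where dt is the coordinate on the ℝ factor, so φ((s,x),(s',y),(s'',z)) = s·ω(y,z) - s'·ω(x,z) + s''·ω(x,y) + ρ(x,y,z)). Then φ is definite (every contraction i_uφ, u ≠ 0, has rank 6) if and only if ρ is definite and there is a complex structure J on V compatible with ρ such that ω(v, Jv) > 0 for every nonzero v ∈ V. -/

import Mathlib

/-- The contraction `i_v ρ` of an alternating 3-form, viewed as the linear map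
`x ↦ (z ↦ ρ (v, x, z))` from `V` to the space of 1-forms. -/
noncomputable def contraction3 {V : Type*} [AddCommGroup V] [Module ℝ V]
    (ρ : V [⋀^Fin 3]→ₗ[ℝ] ℝ) (v : V) : V →ₗ[ℝ] (V [⋀^Fin 1]→ₗ[ℝ] ℝ) :=
  AlternatingMap.curryLeft (ρ.curryLeft v)

/-- A 3-form on a 6-dimensional real vector space is *definite* if for every
nonzero `v` the contraction `i_v ρ` has rank 4. -/
def IsDefinite3Form {V : Type*} [AddCommGroup V] [Module ℝ V]
    (ρ : V [⋀^Fin 3]→ₗ[ℝ] ℝ) : Prop :=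
  ∀ v : V, v ≠ 0 →
    Module.finrank ℝ (LinearMap.range (contraction3 ρ v)) = 4

/-- A 3-form on a 7-dimensional real vector space is *definite* if for every
nonzero `u` the contraction `i_u φ` has rank 6. -/
def IsDefinite3Form7 {U : Type*} [AddCommGroup U] [Module ℝ U]
    (φ : U [⋀^Fin 3]→ₗ[ℝ] ℝ) : Prop :=
  ∀ u : U, u ≠ 0 →
    Module.finrank ℝ (LinearMap.range (contraction3 φ u)) = 6

/-- A complex structure `J` (i.e. `J ∘ J = -id`) is *compatible* with a 3-form `ρ`
if `ρ(Jx, Jy, z) = -ρ(x, y, z)` for all `x, y, z`. -/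
def IsCompatibleComplexStructure {V : Type*} [AddCommGroup V] [Module ℝ V]
    (ρ : V [⋀^Fin 3]→ₗ[ℝ] ℝ) (J : V →ₗ[ℝ] V) : Prop :=
  J ∘ₗ J = -LinearMap.id ∧ ∀ x y z : V, ρ ![J x, J y, z] = - ρ ![x, y, z]

section TrilinearForm

variable {V : Type*} [AddCommGroup V] [Module ℝ V]

/-- An alternating 3-form as a curried trilinear map. -/
noncomputable def AlternatingMap.trilinear (ρ : V [⋀^Fin 3]→ₗ[ℝ] ℝ) : V →ₗ[ℝ] V →ₗ[ℝ] V →ₗ[ℝ] ℝ :=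
  LinearMap.mk₂ ℝ
    (fun a b => (AlternatingMap.constLinearEquivOfIsEmpty (R' := ℝ) (M'' := V) (N'' := ℝ)
      (ι := Fin 0)).symm.toLinearMap ∘ₗ ((ρ.curryLeft a).curryLeft b).curryLeft)
    (by intros; ext; simp) (by intros; ext; simp) (by intros; ext; simp) (by intros; ext; simp)

/-- An alternating 2-form as a curried bilinear map. -/
noncomputable def AlternatingMap.bilinear (ω : V [⋀^Fin 2]→ₗ[ℝ] ℝ) : V →ₗ[ℝ] V →ₗ[ℝ] ℝ :=
  LinearMap.mk₂ ℝ (fun a b => ω ![a, b])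
    (by intros; exact ω.map_vecCons_add ..) (by intros; exact ω.map_vecCons_smul ..)
    (by intro m a b; exact (ω.curryLeft m).map_vecCons_add ![] a b)
    (by intro c m a; exact (ω.curryLeft m).map_vecCons_smul ![] c a)

theorem AlternatingMap.trilinear_apply (ρ : V [⋀^Fin 3]→ₗ[ℝ] ℝ) (a b c : V) :
    ρ.trilinear a b c = ρ ![a, b, c] := by
  simp [AlternatingMap.trilinear, AlternatingMap.constLinearEquivOfIsEmpty]

theorem AlternatingMap.bilinear_apply (ω : V [⋀^Fin 2]→ₗ[ℝ] ℝ) (a b : V) :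
    ω.bilinear a b = ω ![a, b] := rfl

theorem AlternatingMap.bilinear_self (ω : V [⋀^Fin 2]→ₗ[ℝ] ℝ) (a : V) : ω.bilinear a a = 0 :=
  ω.map_eq_zero_of_eq ![a, a] (i := 0) (j := 1) rfl (by decide)

theorem AlternatingMap.bilinear_swap (ω : V [⋀^Fin 2]→ₗ[ℝ] ℝ) (a b : V) :
    ω.bilinear a b = -ω.bilinear b a := by
  have h := ω.bilinear_self (a + b)
  simp only [map_add, LinearMap.add_apply, bilinear_self] at h
  linarith

variable (ρ : V [⋀^Fin 3]→ₗ[ℝ] ℝ)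

theorem AlternatingMap.trilinear_self_left (a b : V) : ρ.trilinear a a b = 0 := by
  rw [trilinear_apply]
  exact ρ.map_eq_zero_of_eq ![a, a, b] (i := 0) (j := 1) rfl (by decide)

theorem AlternatingMap.trilinear_self_right (a b : V) : ρ.trilinear a b b = 0 := by
  rw [trilinear_apply]
  exact ρ.map_eq_zero_of_eq ![a, b, b] (i := 1) (j := 2) rfl (by decide)

theorem AlternatingMap.trilinear_self_outer (a b : V) : ρ.trilinear a b a = 0 := by
  rw [trilinear_apply]
  exact ρ.map_eq_zero_of_eq ![a, b, a] (i := 0) (j := 2) rfl (by decide)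

theorem AlternatingMap.trilinear_swap_left (a b c : V) :
    ρ.trilinear a b c = -ρ.trilinear b a c := by
  have h := ρ.trilinear_self_left (a + b) c
  simp only [map_add, LinearMap.add_apply, trilinear_self_left] at h
  linarith

theorem AlternatingMap.trilinear_swap_right (a b c : V) :
    ρ.trilinear a b c = -ρ.trilinear a c b := by
  have h := ρ.trilinear_self_right a (b + c)
  simp only [map_add, LinearMap.add_apply, trilinear_self_right] at h
  linarith

theorem contraction3_eq_zero_iff (v x : V) : contraction3 ρ v x = 0 ↔ ρ.trilinear v x = 0 := by
  constructor
  · intro h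
    ext z
    rw [AlternatingMap.trilinear_apply]
    exact congrArg (fun f => f ![z]) h
  · intro h
    ext m
    have h' := LinearMap.congr_fun h (m 0)
    rw [AlternatingMap.trilinear_apply] at h'
    rw [show m = ![m 0] by ext i; fin_cases i; rfl]
    exact h'

theorem ker_contraction3 (v : V) :
    LinearMap.ker (contraction3 ρ v) = LinearMap.ker (ρ.trilinear v) :=
  Submodule.ext fun x => contraction3_eq_zero_iff ρ v x

variable [FiniteDimensional ℝ V]

theorem finrank_range_contraction3_add (v : V) :
    Module.finrank ℝ (LinearMap.range (contraction3 ρ v)) +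
      Module.finrank ℝ (LinearMap.ker (ρ.trilinear v)) = Module.finrank ℝ V := by
  rw [← ker_contraction3]
  exact LinearMap.finrank_range_add_finrank_ker _

end TrilinearForm

section FiveForm

variable {V : Type*} [AddCommGroup V] [Module ℝ V]

/-- The 5-form `2 • (i_v ρ ∧ ρ)`, linear in `v`. -/
noncomputable def contractionWedge (ρ : V [⋀^Fin 3]→ₗ[ℝ] ℝ) : V →ₗ[ℝ] V [⋀^Fin 5]→ₗ[ℝ] ℝ where
  toFun v := AlternatingMap.alternatizeUncurryFin (AlternatingMap.alternatizeUncurryFinLM ∘ₗ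
    (ρ.trilinear v).compr₂ (LinearMap.toSpanSingleton ℝ _ ρ))
  map_add' u v := by
    ext m
    simp [AlternatingMap.alternatizeUncurryFin_apply, add_mul, Finset.sum_add_distrib]
  map_smul' c v := by
    ext m
    simp [AlternatingMap.alternatizeUncurryFin_apply, Finset.mul_sum, mul_assoc, mul_left_comm]

theorem contractionWedge_apply (ρ : V [⋀^Fin 3]→ₗ[ℝ] ℝ) (v a b c d e : V) :
    contractionWedge ρ v ![a, b, c, d, e] =
      2 * (ρ.trilinear v a b * ρ.trilinear c d e - ρ.trilinear v a c * ρ.trilinear b d e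
        + ρ.trilinear v a d * ρ.trilinear b c e - ρ.trilinear v a e * ρ.trilinear b c d
        + ρ.trilinear v b c * ρ.trilinear a d e - ρ.trilinear v b d * ρ.trilinear a c e
        + ρ.trilinear v b e * ρ.trilinear a c d + ρ.trilinear v c d * ρ.trilinear a b e
        - ρ.trilinear v c e * ρ.trilinear a b d + ρ.trilinear v d e * ρ.trilinear a b c) := by
  have e3 (m : Fin 3 → V) : ρ m = ρ.trilinear (m 0) (m 1) (m 2) := by
    rw [AlternatingMap.trilinear_apply]
    congr 1
    ext i
    fin_cases i <;> rfl
  simp only [contractionWedge, LinearMap.coe_mk, AddHom.coe_mk,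
    AlternatingMap.alternatizeUncurryFin_apply, LinearMap.comp_apply,
    AlternatingMap.alternatizeUncurryFinLM_apply, LinearMap.compr₂_apply,
    LinearMap.toSpanSingleton_apply, AlternatingMap.smul_apply, e3, Fin.sum_univ_succ,
    Fin.removeNth, Fin.succAbove]
  simp [Fin.lt_def]
  rw [ρ.trilinear_swap_right v b a, ρ.trilinear_swap_right v c a,
    ρ.trilinear_swap_right v d a, ρ.trilinear_swap_right v e a,
    ρ.trilinear_swap_right v c b, ρ.trilinear_swap_right v d b,
    ρ.trilinear_swap_right v e b,
    ρ.trilinear_swap_right v d c, ρ.trilinear_swap_right v e c,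
    ρ.trilinear_swap_right v e d]
  ring

instance finiteDimensional_alternatingMap [FiniteDimensional ℝ V] (n : ℕ) :
    FiniteDimensional ℝ (V [⋀^Fin n]→ₗ[ℝ] ℝ) :=
  Module.Finite.equiv
    (exteriorPower.alternatingMapLinearEquiv (R := ℝ) (M := V) (N := ℝ) (n := n)).symm

theorem finrank_alternatingMap [FiniteDimensional ℝ V] (n : ℕ) :
    Module.finrank ℝ (V [⋀^Fin n]→ₗ[ℝ] ℝ) = (Module.finrank ℝ V).choose n := by
  rw [← exteriorPower.finrank_eq ℝ, ← Subspace.dual_finrank_eq (V := ⋀[ℝ]^n V)]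
  exact (exteriorPower.alternatingMapLinearEquiv (R := ℝ) (M := V) (N := ℝ) (n := n)).finrank_eq

end FiveForm

section ContractionEndomorphism

variable {V : Type*} [AddCommGroup V] [Module ℝ V] [FiniteDimensional ℝ V]

theorem not_linearIndependent_of_det_eq_zero (hdim : Module.finrank ℝ V = 6)
    (b : Module.Basis (Fin 6) ℝ V) {p q r : V} (h : ∀ x y z, b.det ![p, q, r, x, y, z] = 0) :
    ¬ LinearIndependent ℝ ![p, q, r] := by
  intro hli
  obtain ⟨x, hx⟩ := exists_linearIndependent_snoc_of_lt_finrank hli (by omega)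
  obtain ⟨y, hy⟩ := exists_linearIndependent_snoc_of_lt_finrank hx (by omega)
  obtain ⟨z, hz⟩ := exists_linearIndependent_snoc_of_lt_finrank hy (by omega)
  have heq : (Fin.snoc (Fin.snoc (Fin.snoc ![p, q, r] x) y) z : Fin 6 → V) =
      ![p, q, r, x, y, z] := by
    ext i
    fin_cases i <;> rfl
  rw [heq] at hz
  have hu := (Module.Basis.is_basis_iff_det b).1
    ⟨hz, hz.span_eq_top_of_card_eq_finrank' (by simp [hdim])⟩
  rw [h] at hu
  exact not_isUnit_zero hu

theorem exists_endomorphism_det_eq_contractionWedge (hdim : Module.finrank ℝ V = 6)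
    (b : Module.Basis (Fin 6) ℝ V) (ρ : V [⋀^Fin 3]→ₗ[ℝ] ℝ) :
    ∃ K : V →ₗ[ℝ] V, ∀ v m, b.det (Matrix.vecCons (K v) m) = contractionWedge ρ v m := by
  have hinj : Function.Injective b.det.curryLeft := by
    rw [← LinearMap.ker_eq_bot, LinearMap.ker_eq_bot']
    intro k hk
    by_contra hne
    obtain ⟨q, hq⟩ := exists_linearIndependent_pair_of_one_lt_finrank
      (show 1 < Module.finrank ℝ V by omega) hne
    obtain ⟨r, hr⟩ := exists_linearIndependent_snoc_of_lt_finrank hq (by omega)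
    rw [show (Fin.snoc ![k, q] r : Fin 3 → V) = ![k, q, r] by ext i; fin_cases i <;> rfl] at hr
    exact not_linearIndependent_of_det_eq_zero hdim b
      (fun x y z => by
        have h := DFunLike.congr_fun hk ![q, r, x, y, z]
        rwa [AlternatingMap.curryLeft_apply_apply, AlternatingMap.zero_apply] at h) hr
  have hrank : Module.finrank ℝ V = Module.finrank ℝ (V [⋀^Fin 5]→ₗ[ℝ] ℝ) := by
    rw [finrank_alternatingMap, hdim]
    norm_num [Nat.choose]
  obtain ⟨g, hg⟩ := LinearMap.exists_rightInverse_of_surjective b.det.curryLeft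
    (LinearMap.range_eq_top.2
      ((LinearMap.injective_iff_surjective_of_finrank_eq_finrank hrank).1 hinj))
  refine ⟨g ∘ₗ contractionWedge ρ, fun v m => ?_⟩
  rw [← AlternatingMap.curryLeft_apply_apply]
  exact DFunLike.congr_fun (LinearMap.congr_fun hg (contractionWedge ρ v)) m

end ContractionEndomorphism

section Spread

variable {V : Type*} [AddCommGroup V] [Module ℝ V]
  {ρ : V [⋀^Fin 3]→ₗ[ℝ] ℝ} {ω : V [⋀^Fin 2]→ₗ[ℝ] ℝ}

theorem trilinear_eq_zero_symm {x y : V} (h : ρ.trilinear x y = 0) : ρ.trilinear y x = 0 := by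
  ext z
  rw [ρ.trilinear_swap_left, h]
  simp

theorem exists_eq_smul_add_smul
    (h2 : ∀ v y, v ≠ 0 → ρ.trilinear v y = 0 → ω.bilinear v y = 0 → ∃ c : ℝ, y = c • v)
    {v y z : V} (hv : v ≠ 0) (hy : ρ.trilinear v y = 0) (hvy : ∀ c : ℝ, y ≠ c • v)
    (hz : ρ.trilinear v z = 0) : ∃ a b : ℝ, z = a • v + b • y := by
  have hne : ω.bilinear v y ≠ 0 := fun h => by
    obtain ⟨c, hc⟩ := h2 v y hv hy h
    exact hvy c hc
  obtain ⟨c, hc⟩ := h2 v (z - (ω.bilinear v z / ω.bilinear v y) • y) hv (by simp [hy, hz])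
    (by simp [hne])
  exact ⟨c, ω.bilinear v z / ω.bilinear v y, by rw [← hc]; abel⟩

theorem trilinear_eq_zero_trans
    (h2 : ∀ v y, v ≠ 0 → ρ.trilinear v y = 0 → ω.bilinear v y = 0 → ∃ c : ℝ, y = c • v)
    {x y z : V} (hx : x ≠ 0) (hy : ρ.trilinear y x = 0) (hz : ρ.trilinear x z = 0) :
    ρ.trilinear y z = 0 := by
  by_cases h : ∃ c : ℝ, y = c • x
  · obtain ⟨c, rfl⟩ := h
    simp [hz]
  · push Not at h
    obtain ⟨a, b, rfl⟩ := exists_eq_smul_add_smul h2 hx (trilinear_eq_zero_symm hy) h hz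
    ext w
    simp [hy, ρ.trilinear_self_left]

theorem exists_quadratic_eq (hdim : Module.finrank ℝ V = 6)
    (h2 : ∀ v y, v ≠ 0 → ρ.trilinear v y = 0 → ω.bilinear v y = 0 → ∃ c : ℝ, y = c • v)
    {K : V →ₗ[ℝ] V} (hK : ∀ v, ρ.trilinear v (K v) = 0)
    (hK' : ∀ v, v ≠ 0 → ∀ c : ℝ, K v ≠ c • v) :
    ∃ a b : ℝ, ∀ v, K (K v) = a • v + b • K v := by
  have hK0 : ∀ v, v ≠ 0 → K v ≠ 0 := fun v hv h => hK' v hv 0 (by simp [h])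
  have hKK : ∀ v, ρ.trilinear v (K (K v)) = 0 := fun v => by
    rcases eq_or_ne v 0 with rfl | hv
    · simp
    · exact trilinear_eq_zero_trans h2 (hK0 v hv) (hK v) (hK _)
  have : Nontrivial V := Module.nontrivial_of_finrank_pos (R := ℝ) (by omega)
  obtain ⟨u, hu⟩ := exists_ne (0 : V)
  obtain ⟨a, b, hab⟩ := exists_eq_smul_add_smul h2 hu (hK u) (hK' u hu) (hKK u)
  refine ⟨a, b, fun w => ?_⟩
  let P : V →ₗ[ℝ] V := K ∘ₗ K - a • LinearMap.id - b • K
  have hP : ∀ v, P v = K (K v) - a • v - b • K v := fun v => by simp [P]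
  have hPu : P u = 0 := by rw [hP, hab]; module
  have hPKu : P (K u) = 0 := by
    have : P (K u) = K (P u) := by simp [hP]
    rw [this, hPu, map_zero]
  have hrel : ∀ v, ρ.trilinear v (P v) = 0 := fun v => by
    ext z
    simp [hP, hKK, hK, ρ.trilinear_self_left]
  suffices P w = 0 by
    rw [hP] at this
    rwa [sub_sub, sub_eq_zero] at this
  by_contra hne
  have hwu : ρ.trilinear (w + u) (P w) = 0 := by simpa [hPu] using hrel (w + u)
  have hww : ρ.trilinear w (w + u) = 0 :=
    trilinear_eq_zero_trans h2 hne (hrel w) (trilinear_eq_zero_symm hwu)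
  have huw : ρ.trilinear u w = 0 := by
    apply trilinear_eq_zero_symm
    ext z
    simpa [ρ.trilinear_self_left] using LinearMap.congr_fun hww z
  obtain ⟨s, t, rfl⟩ := exists_eq_smul_add_smul h2 hu (hK u) (hK' u hu) huw
  exact hne (by simp [hPu, hPKu])

theorem quadratic_definite_of_ne_zero (B : V →ₗ[ℝ] V →ₗ[ℝ] ℝ) (hB : ∀ v, v ≠ 0 → B v v ≠ 0) :
    (∀ v, v ≠ 0 → 0 < B v v) ∨ ∀ v, v ≠ 0 → B v v < 0 := by
  by_contra! h
  obtain ⟨⟨v, hv, hvB⟩, w, hw, hwB⟩ := h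
  have hvB := lt_of_le_of_ne hvB (hB v hv)
  have hwB := lt_of_le_of_ne hwB (hB w hw).symm
  obtain ⟨t, ht⟩ := exists_quadratic_eq_zero (a := B w w) (b := B v w + B w v) (c := B v v)
    hwB.ne' ⟨√(discrim (B w w) (B v w + B w v) (B v v)), by
      rw [Real.mul_self_sqrt]
      unfold discrim
      nlinarith [sq_nonneg (B v w + B w v), mul_pos hwB (neg_pos.2 hvB)]⟩
  have h0 : v + t • w = 0 := by
    by_contra hne
    apply hB _ hne
    simp only [map_add, map_smul, LinearMap.add_apply, LinearMap.smul_apply, smul_eq_mul]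
    linarith
  rw [eq_neg_of_add_eq_zero_left h0] at hvB
  simp only [map_neg, map_smul, LinearMap.neg_apply, LinearMap.smul_apply, smul_eq_mul] at hvB
  nlinarith [mul_nonneg (mul_self_nonneg t) hwB.le]

theorem trilinear_map_map_of_trilinear_eq_zero {J : V →ₗ[ℝ] V} (hJ : ∀ v, J (J v) = -v)
    (hρ : ∀ v, ρ.trilinear v (J v) = 0) (x y z : V) :
    ρ.trilinear (J x) (J y) z = -ρ.trilinear x y z := by
  have h := LinearMap.congr_fun (hρ (x + J y)) z
  simp only [map_add, LinearMap.add_apply, hρ, hJ, map_neg, LinearMap.neg_apply,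
    LinearMap.zero_apply] at h
  have hy := LinearMap.congr_fun (trilinear_eq_zero_symm (hρ y)) z
  rw [LinearMap.zero_apply] at hy
  rw [ρ.trilinear_swap_left]
  linarith

variable [FiniteDimensional ℝ V]

/-- The contraction `i_v ρ` is not decomposable. -/
theorem exists_pfaffian_ne_zero (hdim : Module.finrank ℝ V = 6)
    (h2 : ∀ v y, v ≠ 0 → ρ.trilinear v y = 0 → ω.bilinear v y = 0 → ∃ c : ℝ, y = c • v)
    {v : V} (hv : v ≠ 0) :
    ∃ a b c d, ρ.trilinear v a b * ρ.trilinear v c d - ρ.trilinear v a c * ρ.trilinear v b d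
      + ρ.trilinear v a d * ρ.trilinear v b c ≠ 0 := by
  by_contra! h
  obtain ⟨a, b, hab⟩ : ∃ a b, ∀ z, ρ.trilinear v a z = 0 → ρ.trilinear v b z = 0 →
      ρ.trilinear v z = 0 := by
    by_cases h0 : ∃ a b, ρ.trilinear v a b ≠ 0
    · obtain ⟨a, b, hab⟩ := h0
      refine ⟨a, b, fun z ha hb => ?_⟩
      ext w
      have := h a b z w
      rw [ha, hb] at this
      simpa [hab] using this
    · push Not at h0
      exact ⟨0, 0, fun z _ _ => by ext w; exact h0 z w⟩
  let L : V →ₗ[ℝ] ℝ × ℝ × ℝ :=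
    (ρ.trilinear v a).prod ((ρ.trilinear v b).prod (ω.bilinear v))
  have hker : LinearMap.ker L ≤ Submodule.span ℝ {v} := by
    intro z hz
    simp only [L, LinearMap.mem_ker, LinearMap.prod_apply, Function.prod, Prod.mk_eq_zero] at hz
    obtain ⟨c, hc⟩ := h2 v z hv (hab z hz.1 hz.2.1) hz.2.2
    exact Submodule.mem_span_singleton.2 ⟨c, hc.symm⟩
  have h1 := Submodule.finrank_mono hker
  rw [finrank_span_singleton hv] at h1
  have h3 := L.finrank_range_add_finrank_ker
  have h4 := Submodule.finrank_le (LinearMap.range L)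
  simp at h4
  omega

theorem exists_endomorphism_trilinear_eq_zero (hdim : Module.finrank ℝ V = 6)
    (h1 : ∀ v, v ≠ 0 → ∃ y, ρ.trilinear v y = 0 ∧ ω.bilinear v y = 1)
    (h2 : ∀ v y, v ≠ 0 → ρ.trilinear v y = 0 → ω.bilinear v y = 0 → ∃ c : ℝ, y = c • v) :
    ∃ K : V →ₗ[ℝ] V, (∀ v, ρ.trilinear v (K v) = 0) ∧ ∀ v, v ≠ 0 → ∀ c : ℝ, K v ≠ c • v := by
  let b := Module.finBasisOfFinrankEq ℝ V hdim
  obtain ⟨K, hK⟩ := exists_endomorphism_det_eq_contractionWedge hdim b ρ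
  refine ⟨K, fun v => ?_, fun v hv c hc => ?_⟩
  · rcases eq_or_ne v 0 with rfl | hv
    · simp
    obtain ⟨y, hy, hvy⟩ := h1 v hv
    have hdep := not_linearIndependent_of_det_eq_zero hdim b (p := K v) (q := v) (r := y)
      fun x z w => by
        rw [hK, contractionWedge_apply]
        simp [ρ.trilinear_self_left, hy]
    have hli : LinearIndependent ℝ ![v, y] := by
      rw [LinearIndependent.pair_iff' hv]
      rintro c rfl
      simp [ω.bilinear_self] at hvy
    have hmem : K v ∈ Submodule.span ℝ (Set.range ![v, y]) := by
      by_contra hmem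
      exact hdep (linearIndependent_finCons.2 ⟨hli, hmem⟩)
    rw [Matrix.range_cons_cons_empty, Submodule.mem_span_pair] at hmem
    obtain ⟨s, t, hst⟩ := hmem
    rw [← hst]
    ext w
    simp [ρ.trilinear_self_left, hy]
  · obtain ⟨x, y, z, w, hne⟩ := exists_pfaffian_ne_zero hdim h2 hv
    have h := hK v ![v, x, y, z, w]
    rw [hc, b.det.map_vecCons_smul, b.det.map_eq_zero_of_eq ![v, v, x, y, z, w] (i := 0) (j := 1)
      rfl (by decide), contractionWedge_apply] at h
    simp only [ρ.trilinear_self_left] at h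
    apply hne
    simp at h
    linarith

theorem exists_complex_structure_trilinear_eq_zero (hdim : Module.finrank ℝ V = 6)
    (h1 : ∀ v, v ≠ 0 → ∃ y, ρ.trilinear v y = 0 ∧ ω.bilinear v y = 1)
    (h2 : ∀ v y, v ≠ 0 → ρ.trilinear v y = 0 → ω.bilinear v y = 0 → ∃ c : ℝ, y = c • v) :
    ∃ J : V →ₗ[ℝ] V, (∀ v, J (J v) = -v) ∧ ∀ v, ρ.trilinear v (J v) = 0 := by
  obtain ⟨K, hK, hK'⟩ := exists_endomorphism_trilinear_eq_zero hdim h1 h2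
  obtain ⟨a, b, hab⟩ := exists_quadratic_eq hdim h2 hK hK'
  have : Nontrivial V := Module.nontrivial_of_finrank_pos (R := ℝ) (by omega)
  obtain ⟨u, hu⟩ := exists_ne (0 : V)
  have hdisc : 0 < -(a + b ^ 2 / 4) := by
    by_contra! hle
    have hs := Real.sq_sqrt (show 0 ≤ a + b ^ 2 / 4 by linarith)
    set s := √(a + b ^ 2 / 4)
    refine hK' (K u - (b / 2 - s) • u) (sub_ne_zero.2 (hK' u hu _)) (b / 2 + s) ?_
    rw [map_sub, map_smul, hab]
    have ha : a = s ^ 2 - b ^ 2 / 4 := by linarith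
    rw [ha]
    module
  have hs := Real.sq_sqrt hdisc.le
  have hs0 := Real.sqrt_pos.2 hdisc
  set s := √(-(a + b ^ 2 / 4))
  refine ⟨s⁻¹ • (K - (b / 2) • LinearMap.id), fun v => ?_, fun v => ?_⟩
  · have ha : a = -s ^ 2 - b ^ 2 / 4 := by linarith
    simp only [LinearMap.smul_apply, LinearMap.sub_apply, LinearMap.id_apply, map_smul, map_sub,
      hab, ha]
    match_scalars <;> field_simp <;> ring
  · ext z
    simp [hK, ρ.trilinear_self_left]

theorem exists_taming_compatible_complex_structure (hdim : Module.finrank ℝ V = 6)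
    (h1 : ∀ v, v ≠ 0 → ∃ y, ρ.trilinear v y = 0 ∧ ω.bilinear v y = 1)
    (h2 : ∀ v y, v ≠ 0 → ρ.trilinear v y = 0 → ω.bilinear v y = 0 → ∃ c : ℝ, y = c • v) :
    ∃ J : V →ₗ[ℝ] V, IsCompatibleComplexStructure ρ J ∧ ∀ v, v ≠ 0 → 0 < ω ![v, J v] := by
  have key : ∀ J : V →ₗ[ℝ] V, (∀ v, J (J v) = -v) → (∀ v, ρ.trilinear v (J v) = 0) →
      IsCompatibleComplexStructure ρ J := fun J hJ hρ => by
    refine ⟨LinearMap.ext hJ, fun x y z => ?_⟩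
    simpa only [AlternatingMap.trilinear_apply] using
      trilinear_map_map_of_trilinear_eq_zero hJ hρ x y z
  obtain ⟨J, hJ, hρ⟩ := exists_complex_structure_trilinear_eq_zero hdim h1 h2
  have hne : ∀ v, v ≠ 0 → ω.bilinear v (J v) ≠ 0 := fun v hv h => by
    obtain ⟨c, hc⟩ := h2 v (J v) hv (hρ v) h
    have h' := hJ v
    rw [hc, map_smul, hc, smul_smul, ← neg_one_smul ℝ v] at h'
    nlinarith [smul_left_injective ℝ hv h', mul_self_nonneg c]
  rcases quadratic_definite_of_ne_zero (ω.bilinear.compl₂ J) hne with h | h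
  · exact ⟨J, key J hJ hρ, h⟩
  · refine ⟨-J, key (-J) (by simp [hJ]) (by simp [hρ]), fun v hv => ?_⟩
    rw [← ω.bilinear_apply, LinearMap.neg_apply, map_neg]
    exact neg_pos.2 (h v hv)

end Spread

section Main

variable {V : Type*} [AddCommGroup V] [Module ℝ V]
  {ρ : V [⋀^Fin 3]→ₗ[ℝ] ℝ} {ω : V [⋀^Fin 2]→ₗ[ℝ] ℝ}

theorem IsCompatibleComplexStructure.apply_apply {J : V →ₗ[ℝ] V}
    (hJ : IsCompatibleComplexStructure ρ J) (x : V) : J (J x) = -x :=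
  LinearMap.congr_fun hJ.1 x

theorem IsCompatibleComplexStructure.trilinear_map_map {J : V →ₗ[ℝ] V}
    (hJ : IsCompatibleComplexStructure ρ J) (x y z : V) :
    ρ.trilinear (J x) (J y) z = -ρ.trilinear x y z := by
  simpa only [AlternatingMap.trilinear_apply] using hJ.2 x y z

theorem IsCompatibleComplexStructure.trilinear_self_map {J : V →ₗ[ℝ] V}
    (hJ : IsCompatibleComplexStructure ρ J) (x : V) : ρ.trilinear x (J x) = 0 := by
  ext z
  have h := hJ.trilinear_map_map x (J x) z
  rw [hJ.apply_apply, map_neg, LinearMap.neg_apply, ρ.trilinear_swap_left] at h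
  rw [LinearMap.zero_apply]
  linarith

variable [FiniteDimensional ℝ V]

theorem exists_eq_smul_of_finrank_range_contraction3 {n : ℕ}
    (hdim : Module.finrank ℝ V = n + 1) {v : V} (hv : v ≠ 0)
    (h : Module.finrank ℝ (LinearMap.range (contraction3 ρ v)) = n) {y : V}
    (hy : ρ.trilinear v y = 0) : ∃ c : ℝ, y = c • v := by
  have hadd := finrank_range_contraction3_add ρ v
  have hker : Module.finrank ℝ (LinearMap.ker (ρ.trilinear v)) = 1 := by omega
  have hle : Submodule.span ℝ {v} ≤ LinearMap.ker (ρ.trilinear v) := by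
    rw [Submodule.span_singleton_le_iff_mem]
    ext z
    exact ρ.trilinear_self_left v z
  have heq := Submodule.eq_of_le_of_finrank_eq hle (by rw [finrank_span_singleton hv, hker])
  have hmem : y ∈ LinearMap.ker (ρ.trilinear v) := hy
  rw [← heq, Submodule.mem_span_singleton] at hmem
  obtain ⟨c, hc⟩ := hmem
  exact ⟨c, hc.symm⟩

theorem exists_trilinear_eq_of_finrank_range_contraction3 {n : ℕ}
    (hdim : Module.finrank ℝ V = n + 1) {v : V} (hv : v ≠ 0)
    (h : Module.finrank ℝ (LinearMap.range (contraction3 ρ v)) = n) {f : V →ₗ[ℝ] ℝ}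
    (hf : f v = 0) : ∃ y, ρ.trilinear v y = f := by
  have h1 := finrank_range_contraction3_add ρ v
  have h2 := (ρ.trilinear v).finrank_range_add_finrank_ker
  have h3 := Subspace.finrank_add_finrank_dualAnnihilator_eq (Submodule.span ℝ {v})
  rw [finrank_span_singleton hv] at h3
  have hle : LinearMap.range (ρ.trilinear v) ≤ (Submodule.span ℝ {v}).dualAnnihilator := by
    rintro _ ⟨y, rfl⟩
    rw [Submodule.mem_dualAnnihilator]
    intro w hw
    obtain ⟨c, rfl⟩ := Submodule.mem_span_singleton.1 hw
    simp [ρ.trilinear_self_outer]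
  have h4 : Module.finrank ℝ (LinearMap.range (ρ.trilinear v)) = n := by omega
  have h5 : Module.finrank ℝ (Submodule.span ℝ {v}).dualAnnihilator = n := by omega
  have heq := Submodule.eq_of_le_of_finrank_eq hle (h4.trans h5.symm)
  have hmem : f ∈ (Submodule.span ℝ {v}).dualAnnihilator := by
    rw [Submodule.mem_dualAnnihilator]
    intro w hw
    obtain ⟨c, rfl⟩ := Submodule.mem_span_singleton.1 hw
    simp [hf]
  rwa [← heq] at hmem

theorem finrank_range_contraction3_of_forall_eq_smul {n : ℕ}
    (hdim : Module.finrank ℝ V = n + 1) {v : V} (hv : v ≠ 0)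
    (h : ∀ y, ρ.trilinear v y = 0 → ∃ c : ℝ, y = c • v) :
    Module.finrank ℝ (LinearMap.range (contraction3 ρ v)) = n := by
  have hadd := finrank_range_contraction3_add ρ v
  have heq : LinearMap.ker (ρ.trilinear v) = Submodule.span ℝ {v} := by
    apply le_antisymm
    · intro y hy
      obtain ⟨c, hc⟩ := h y hy
      exact Submodule.mem_span_singleton.2 ⟨c, hc.symm⟩
    · rw [Submodule.span_singleton_le_iff_mem]
      ext z
      exact ρ.trilinear_self_left v z
  rw [heq, finrank_span_singleton hv] at hadd
  omega

theorem isDefinite3Form_of_bilinear (hdim : Module.finrank ℝ V = 6)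
    (h1 : ∀ v, v ≠ 0 → ∃ y, ρ.trilinear v y = 0 ∧ ω.bilinear v y = 1)
    (h2 : ∀ v y, v ≠ 0 → ρ.trilinear v y = 0 → ω.bilinear v y = 0 → ∃ c : ℝ, y = c • v) :
    IsDefinite3Form ρ := by
  intro v hv
  obtain ⟨y, hy, hvy⟩ := h1 v hv
  have hne : ∀ c : ℝ, y ≠ c • v := by
    rintro c rfl
    simp [ω.bilinear_self] at hvy
  have hadd := finrank_range_contraction3_add ρ v
  have heq : LinearMap.ker (ρ.trilinear v) = Submodule.span ℝ (Set.range ![v, y]) := by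
    rw [Matrix.range_cons_cons_empty]
    ext z
    rw [Submodule.mem_span_pair]
    constructor
    · intro hz
      obtain ⟨a, b, h⟩ := exists_eq_smul_add_smul h2 hv hy hne hz
      exact ⟨a, b, h.symm⟩
    · rintro ⟨a, b, rfl⟩
      ext w
      simp [hy, ρ.trilinear_self_left]
  have hli : LinearIndependent ℝ ![v, y] :=
    (LinearIndependent.pair_iff' hv).2 fun c => (hne c).symm
  rw [heq, finrank_span_eq_card hli, Fintype.card_fin] at hadd
  omega

theorem exists_eq_smul_of_isDefinite3Form (hdim : Module.finrank ℝ V = 6)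
    (hρ : IsDefinite3Form ρ) {J : V →ₗ[ℝ] V} (hJ : IsCompatibleComplexStructure ρ J)
    (hω : ∀ v, v ≠ 0 → 0 < ω.bilinear v (J v)) {x y : V} (hx : x ≠ 0)
    (hy : ρ.trilinear x y = 0) (hxy : ω.bilinear x y = 0) : ∃ c : ℝ, y = c • x := by
  have hadd := finrank_range_contraction3_add ρ x
  rw [hρ x hx] at hadd
  have hli : LinearIndependent ℝ ![x, J x] := by
    rw [LinearIndependent.pair_iff' hx]
    intro c hc
    have := hω x hx
    simp [← hc, ω.bilinear_self] at this
  have hle : Submodule.span ℝ (Set.range ![x, J x]) ≤ LinearMap.ker (ρ.trilinear x) := by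
    rw [Matrix.range_cons_cons_empty, Submodule.span_le, Set.pair_subset_iff]
    exact ⟨LinearMap.ext (ρ.trilinear_self_left x), hJ.trilinear_self_map x⟩
  have heq := Submodule.eq_of_le_of_finrank_eq hle (by
    rw [finrank_span_eq_card hli, Fintype.card_fin]
    omega)
  have hmem : y ∈ LinearMap.ker (ρ.trilinear x) := hy
  rw [← heq, Matrix.range_cons_cons_empty, Submodule.mem_span_pair] at hmem
  obtain ⟨a, b, rfl⟩ := hmem
  have hb : b = 0 := by simpa [ω.bilinear_self, (hω x hx).ne'] using hxy
  exact ⟨a, by simp [hb]⟩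

end Main

/-- let `ρ` be a 3-form and `ω` a 2-form on a 6-dimensional real
vector space `V`, and let `φ = ω ∧ dt + ρ` be the induced 3-form on `ℝ ⊕ V`.
Then `φ` is definite if and only if `ρ` is definite and some complex structure `J`
compatible with `ρ` is tamed by `ω`, i.e. `ω(v, Jv) > 0` for all nonzero `v`. -/
theorem definite7_iff_definite_and_taming
    {V : Type*} [AddCommGroup V] [Module ℝ V] [FiniteDimensional ℝ V]
    (hdim : Module.finrank ℝ V = 6)
    (ρ : V [⋀^Fin 3]→ₗ[ℝ] ℝ) (ω : V [⋀^Fin 2]→ₗ[ℝ] ℝ)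
    (φ : (ℝ × V) [⋀^Fin 3]→ₗ[ℝ] ℝ)
    (hφ : ∀ (s s' s'' : ℝ) (x y z : V),
      φ ![(s, x), (s', y), (s'', z)] =
        s * ω ![y, z] - s' * ω ![x, z] + s'' * ω ![x, y] + ρ ![x, y, z]) :
    IsDefinite3Form7 φ ↔
      (IsDefinite3Form ρ ∧
        ∃ J : V →ₗ[ℝ] V, IsCompatibleComplexStructure ρ J ∧
          ∀ v : V, v ≠ 0 → 0 < ω ![v, J v]) := by
  have hφ' : ∀ (s s' s'' : ℝ) (x y z : V), φ.trilinear (s, x) (s', y) (s'', z) =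
      s * ω.bilinear y z - s' * ω.bilinear x z + s'' * ω.bilinear x y + ρ.trilinear x y z := by
    simpa only [AlternatingMap.trilinear_apply, AlternatingMap.bilinear_apply] using hφ
  have hdimU : Module.finrank ℝ (ℝ × V) = 6 + 1 := by simp [hdim, add_comm]
  constructor
  · intro h
    have hne : ∀ v : V, v ≠ 0 → ((0, v) : ℝ × V) ≠ 0 := fun v hv h0 => hv (Prod.ext_iff.1 h0).2
    have h1 : ∀ v, v ≠ 0 → ∃ y, ρ.trilinear v y = 0 ∧ ω.bilinear v y = 1 := fun v hv => by
      obtain ⟨⟨s, y⟩, hw⟩ := exists_trilinear_eq_of_finrank_range_contraction3 hdimU (hne v hv)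
        (h _ (hne v hv)) (f := LinearMap.fst ℝ ℝ V) rfl
      have hs := LinearMap.congr_fun hw (s, y)
      rw [φ.trilinear_self_right, LinearMap.fst_apply] at hs
      obtain rfl : s = 0 := hs.symm
      refine ⟨y, LinearMap.ext fun z => ?_, ?_⟩
      · simpa [hφ'] using LinearMap.congr_fun hw (0, z)
      · simpa [hφ'] using LinearMap.congr_fun hw (1, 0)
    have h2 : ∀ v y, v ≠ 0 → ρ.trilinear v y = 0 → ω.bilinear v y = 0 → ∃ c : ℝ, y = c • v :=
      fun v y hv hy hvy => by
        obtain ⟨c, hc⟩ := exists_eq_smul_of_finrank_range_contraction3 hdimU (hne v hv)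
          (h _ (hne v hv)) (y := (0, y)) (LinearMap.ext fun ⟨s, z⟩ => by simp [hφ', hy, hvy])
        exact ⟨c, (Prod.ext_iff.1 hc).2⟩
    exact ⟨isDefinite3Form_of_bilinear hdim h1 h2,
      exists_taming_compatible_complex_structure hdim h1 h2⟩
  · rintro ⟨hρ, J, hJ, hω⟩ ⟨s, x⟩ hu
    change ∀ v, v ≠ 0 → 0 < ω.bilinear v (J v) at hω
    refine finrank_range_contraction3_of_forall_eq_smul hdimU hu ?_
    rintro ⟨s', y⟩ hw
    have hxy : ω.bilinear x y = 0 := by simpa [hφ'] using LinearMap.congr_fun hw (1, 0)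
    have hz : ∀ z, ω.bilinear (s • y - s' • x) z + ρ.trilinear x y z = 0 := fun z => by
      simpa [hφ'] using LinearMap.congr_fun hw (0, z)
    by_cases hs : s = 0
    · subst hs
      have hx : x ≠ 0 := by
        rintro rfl
        exact hu rfl
      have hs' : s' = 0 := by
        have h := hz (J x)
        rw [ρ.trilinear_swap_right, hJ.trilinear_self_map] at h
        simpa [(hω x hx).ne'] using h
      subst hs'
      obtain ⟨c, rfl⟩ := exists_eq_smul_of_isDefinite3Form hdim hρ hJ hω hx
        (LinearMap.ext fun z => by simpa using hz z) hxy
      exact ⟨c, by simp⟩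
    · have hp : s • y - s' • x = 0 := by
        by_contra hp
        have h := hz (J (s • y - s' • x))
        have h0 : s * ρ.trilinear x y (J (s • y - s' • x)) = 0 := by
          calc s * ρ.trilinear x y (J (s • y - s' • x))
              = ρ.trilinear x (s • y - s' • x) (J (s • y - s' • x)) := by
                simp only [map_sub, map_smul, LinearMap.sub_apply, LinearMap.smul_apply,
                  smul_eq_mul, ρ.trilinear_self_left]
                ring
            _ = 0 := by
                rw [ρ.trilinear_swap_left, ρ.trilinear_swap_right, hJ.trilinear_self_map]
                simp
        have h1 : ρ.trilinear x y (J (s • y - s' • x)) = 0 := by simpa [hs] using h0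
        rw [h1, add_zero] at h
        exact (hω _ hp).ne' h
      refine ⟨s' / s, Prod.ext (by simp [hs]) ?_⟩
      rw [sub_eq_zero] at hp
      change y = (s' / s) • x
      rw [div_eq_inv_mul, mul_smul, ← hp, inv_smul_smul₀ hs]
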